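/- arXiv:1811.01501 — 7 statements merged into one kernel-verified Lean document; each statement's English description precedes it below -/
import Mathlib

section
/- Let φ: ℝ → ℝ be a strictly increasing continuous bijection and define f(x) = ∫₀ˣ (φ⁻¹(t) − t) dt. Then for every y ∈ ℝ, the function x ↦ f(x) + ½(x − y)² has a unique minimizer over ℝ, namely x = φ(y). -/
theorem prox_of_f_is_activation (φ : ℝ ≃ ℝ) (hφ : StrictMono φ)
    (hφc : Continuous φ) (y : ℝ) :
    ∀ x : ℝ, x ≠ φ y →
      (∫ t in (0:ℝ)..(φ y), (φ.symm t - t)) + (φ y - y) ^ 2 / 2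
        < (∫ t in (0:ℝ)..x, (φ.symm t - t)) + (x - y) ^ 2 / 2 := by
  intro x hx
  have hs : StrictMono φ.symm := by
    intro a b hab
    apply hφ.lt_iff_lt.mp
    simpa using hab
  have hc : Continuous φ.symm := hs.monotone.continuous_of_surjective φ.symm.surjective
  have key : ∀ z : ℝ, (∫ t in (0:ℝ)..z, (φ.symm t - t)) + (z - y) ^ 2 / 2
      = (∫ t in (0:ℝ)..z, (φ.symm t - y)) + y ^ 2 / 2 := by
    intro z
    rw [intervalIntegral.integral_sub (hc.intervalIntegrable _ _)
        ((by fun_prop : Continuous fun t : ℝ => t).intervalIntegrable _ _),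
      intervalIntegral.integral_sub (hc.intervalIntegrable _ _)
        (continuous_const.intervalIntegrable _ _)]
    simp only [integral_id, intervalIntegral.integral_const, smul_eq_mul]
    ring
  have hc2 : Continuous fun t => φ.symm t - y := hc.sub continuous_const
  have hadd := intervalIntegral.integral_add_adjacent_intervals
    (hc2.intervalIntegrable (μ := MeasureTheory.volume) 0 (φ y))
    (hc2.intervalIntegrable (φ y) x)
  have hpos : 0 < ∫ t in (φ y)..x, (φ.symm t - y) := by
    rcases lt_or_gt_of_ne hx with h | h
    · rw [intervalIntegral.integral_symm, ← intervalIntegral.integral_neg]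
      apply intervalIntegral.intervalIntegral_pos_of_pos_on
        (hc2.neg.intervalIntegrable _ _) _ h
      intro t ht
      have := hs ht.2
      rw [Equiv.symm_apply_apply] at this
      show 0 < -(φ.symm t - y)
      linarith
    · apply intervalIntegral.intervalIntegral_pos_of_pos_on
        (hc2.intervalIntegrable _ _) _ h
      intro t ht
      have := hs ht.1
      rw [Equiv.symm_apply_apply] at this
      linarith
  rw [key, key]
  linarith
end

section
/- Let φ: ℝ → ℝ be a strictly increasing continuous bijection and define f(x) = ∫₀ˣ (φ⁻¹(t) − t) dt, applied entrywise to matrices. Then for every matrix M ∈ ℝ^{p×m}, the function X ∈ ℝ^{p×m} ↦ Σ_{k,l} f(X_{kl}) + ½‖X − M‖²_F has the unique minimizer X = φ(M), where φ is applied entrywise. -/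
open Matrix

theorem scalar_prox_aux (φ : ℝ ≃ ℝ) (hφ : StrictMono φ) (a x : ℝ) (hx : x ≠ φ a) :
    (∫ t in (0:ℝ)..(φ a), (φ.symm t - t)) + (1 / 2) * (φ a - a) ^ 2
      < (∫ t in (0:ℝ)..x, (φ.symm t - t)) + (1 / 2) * (x - a) ^ 2 := by
  have hs : StrictMono φ.symm := by
    intro u v huv
    apply hφ.lt_iff_lt.mp
    simpa using huv
  have hc : Continuous φ.symm := hs.monotone.continuous_of_surjective φ.symm.surjective
  have hi : ∀ u v : ℝ, IntervalIntegrable (fun t => φ.symm t - t) MeasureTheory.volume u v :=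
    fun u v => (hc.sub continuous_id).intervalIntegrable u v
  have hi2 : ∀ u v : ℝ, IntervalIntegrable (fun t => φ.symm t - a) MeasureTheory.volume u v :=
    fun u v => (hc.sub continuous_const).intervalIntegrable u v
  have hi3 : ∀ u v : ℝ, IntervalIntegrable (fun t => a - φ.symm t) MeasureTheory.volume u v :=
    fun u v => (continuous_const.sub hc).intervalIntegrable u v
  have hi4 : ∀ u v : ℝ, IntervalIntegrable (fun t : ℝ => t - a) MeasureTheory.volume u v :=
    fun u v => (continuous_id.sub continuous_const).intervalIntegrable u v
  have h1 := intervalIntegral.integral_interval_sub_left (hi 0 x) (hi 0 (φ a))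
  have h2 : (∫ t in (φ a)..x, (φ.symm t - t))
      = (∫ t in (φ a)..x, (φ.symm t - a)) - ∫ t in (φ a)..x, (t - a) := by
    rw [← intervalIntegral.integral_sub (hi2 _ _) (hi4 _ _)]
    congr 1
    ext t
    ring
  have h3 : (∫ t in (φ a)..x, (t - a)) = ((x - a) ^ 2 - (φ a - a) ^ 2) / 2 := by
    rw [intervalIntegral.integral_sub (continuous_id'.intervalIntegrable _ _)
      (continuous_const.intervalIntegrable _ _), integral_id, intervalIntegral.integral_const]
    simp only [smul_eq_mul]
    ring
  have h4 : 0 < ∫ t in (φ a)..x, (φ.symm t - a) := by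
    rcases lt_or_gt_of_ne hx with h | h
    · have : 0 < ∫ t in x..(φ a), (a - φ.symm t) := by
        apply intervalIntegral.intervalIntegral_pos_of_pos_on (hi3 _ _) _ h
        intro t ht
        have := hs ht.2
        simp only [Equiv.symm_apply_apply] at this
        linarith
      rw [intervalIntegral.integral_symm, ← intervalIntegral.integral_neg]
      simpa using this
    · apply intervalIntegral.intervalIntegral_pos_of_pos_on (hi2 _ _) _ h
      intro t ht
      have := hs ht.1
      simp only [Equiv.symm_apply_apply] at this
      linarith
  linarith

theorem matrix_prox_of_f_is_activation (p m : ℕ) (φ : ℝ ≃ ℝ)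
    (hφ : StrictMono φ) (hφc : Continuous φ)
    (M : Matrix (Fin p) (Fin m) ℝ) :
    ∀ X : Matrix (Fin p) (Fin m) ℝ, X ≠ M.map φ →
      (∑ k, ∑ l, ∫ t in (0:ℝ)..(M.map φ k l), (φ.symm t - t))
          + (1 / 2) * ∑ k, ∑ l, (M.map φ k l - M k l) ^ 2
        < (∑ k, ∑ l, ∫ t in (0:ℝ)..(X k l), (φ.symm t - t))
          + (1 / 2) * ∑ k, ∑ l, (X k l - M k l) ^ 2 := by
  intro X hX
  have hle : ∀ k l, (∫ t in (0:ℝ)..(M.map φ k l), (φ.symm t - t))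
        + (1 / 2) * (M.map φ k l - M k l) ^ 2
      ≤ (∫ t in (0:ℝ)..(X k l), (φ.symm t - t)) + (1 / 2) * (X k l - M k l) ^ 2 := by
    intro k l
    by_cases h : X k l = M.map φ k l
    · rw [h]
    · exact (scalar_prox_aux φ hφ (M k l) (X k l) h).le
  obtain ⟨k, l, hkl⟩ : ∃ k l, X k l ≠ M.map φ k l := by
    by_contra hcon
    push Not at hcon
    exact hX (Matrix.ext hcon)
  simp only [Finset.mul_sum, ← Finset.sum_add_distrib]
  refine Finset.sum_lt_sum (fun i _ => Finset.sum_le_sum fun j _ => hle i j)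
    ⟨k, Finset.mem_univ k, Finset.sum_lt_sum (fun j _ => hle k j) ⟨l, Finset.mem_univ l, ?_⟩⟩
  exact scalar_prox_aux φ hφ (M k l) (X k l) hkl
end

section
/- Let φ: ℝ → ℝ be differentiable with |φ′(x)| ≤ γ for all x, let W ∈ ℝ^{p×q}, C ∈ ℝ^{q×m}, B ∈ ℝ^{p×m}, r > 0, and define the map T: ℝ^{q×m} → ℝ^{q×m} by T(X) = φ(C − r Wᵀ(φ(WX) − B)), with φ applied entrywise. Set ρ = r γ² √(‖|Wᵀ||W|‖₁ · ‖|Wᵀ||W|‖_∞). Then T is ρ-Lipschitz in the Frobenius norm, and if ρ < 1 the iteration X^{t+1} = T(X^t) converges linearly: there exists a unique fixed point X* of T and ‖X^t − X*‖_F ≤ ρᵗ ‖X⁰ − X*‖_F for all t ≥ 0. -/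
open Matrix

noncomputable def frobNorm {p m : ℕ} (M : Matrix (Fin p) (Fin m) ℝ) : ℝ :=
  Real.sqrt (∑ k, ∑ l, (M k l) ^ 2)

lemma schur_test {q : ℕ} (A : Matrix (Fin q) (Fin q) ℝ) (hA : ∀ i j, 0 ≤ A i j) (d : Fin q → ℝ)
    (R S : ℝ) (hR : ∀ i, ∑ j, A i j ≤ R) (hS : ∀ j, ∑ i, A i j ≤ S) (hR0 : 0 ≤ R) :
    ∑ k, (∑ j, A k j * d j) ^ 2 ≤ S * R * ∑ j, d j ^ 2 := by
  have h1 : ∀ k, (∑ j, A k j * d j) ^ 2 ≤ R * ∑ j, A k j * d j ^ 2 := by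
    intro k
    have h := Finset.sum_sq_le_sum_mul_sum_of_sq_eq_mul Finset.univ
      (r := fun j => A k j * d j) (f := fun j => A k j) (g := fun j => A k j * d j ^ 2)
      (fun j _ => hA k j) (fun j _ => mul_nonneg (hA k j) (sq_nonneg _)) (fun j _ => by ring)
    refine h.trans (mul_le_mul_of_nonneg_right (hR k) ?_)
    exact Finset.sum_nonneg fun j _ => mul_nonneg (hA k j) (sq_nonneg _)
  calc ∑ k, (∑ j, A k j * d j) ^ 2 ≤ ∑ k, R * ∑ j, A k j * d j ^ 2 :=
        Finset.sum_le_sum fun k _ => h1 k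
    _ = R * ∑ j, (∑ k, A k j) * d j ^ 2 := by
        rw [← Finset.mul_sum, Finset.sum_comm]
        simp_rw [Finset.sum_mul]
    _ ≤ R * ∑ j, S * d j ^ 2 := by
        refine mul_le_mul_of_nonneg_left ?_ hR0
        exact Finset.sum_le_sum fun j _ => mul_le_mul_of_nonneg_right (hS j) (sq_nonneg _)
    _ = S * R * ∑ j, d j ^ 2 := by rw [← Finset.mul_sum]; ring

lemma contraction_fixed {q m : ℕ} (T : Matrix (Fin q) (Fin m) ℝ → Matrix (Fin q) (Fin m) ℝ)
    (ρ : ℝ) (h0 : 0 ≤ ρ) (h1 : ρ < 1)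
    (hL : ∀ X Y, frobNorm (T X - T Y) ≤ ρ * frobNorm (X - Y)) :
    ∃ Xstar, T Xstar = Xstar ∧ (∀ Y, T Y = Y → Y = Xstar) := by
  letI : NormedAddCommGroup (Matrix (Fin q) (Fin m) ℝ) := Matrix.frobeniusNormedAddCommGroup
  letI : NormedSpace ℝ (Matrix (Fin q) (Fin m) ℝ) := Matrix.frobeniusNormedSpace
  haveI : CompleteSpace (Matrix (Fin q) (Fin m) ℝ) := FiniteDimensional.complete ℝ _
  have hn : ∀ M : Matrix (Fin q) (Fin m) ℝ, frobNorm M = ‖M‖ := by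
    intro M
    rw [Matrix.frobenius_norm_def, frobNorm, Real.sqrt_eq_rpow]
    simp
  have hc : ContractingWith ⟨ρ, h0⟩ T := by
    refine ⟨by exact_mod_cast h1, LipschitzWith.of_dist_le_mul fun X Y => ?_⟩
    rw [dist_eq_norm, dist_eq_norm, ← hn, ← hn]
    exact hL X Y
  exact ⟨hc.fixedPoint T, hc.fixedPoint_isFixedPt, fun Y hY => hc.fixedPoint_unique hY⟩

theorem activation_update_convergence (p q m : ℕ) (φ : ℝ → ℝ) (γ : ℝ)
    (hφ : Differentiable ℝ φ) (hγ : ∀ x, |deriv φ x| ≤ γ)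
    (W : Matrix (Fin p) (Fin q) ℝ) (C : Matrix (Fin q) (Fin m) ℝ)
    (B : Matrix (Fin p) (Fin m) ℝ) (r : ℝ) (hr : 0 < r)
    (T : Matrix (Fin q) (Fin m) ℝ → Matrix (Fin q) (Fin m) ℝ)
    (hT : ∀ X, T X = (C - r • (Wᵀ * ((W * X).map φ - B))).map φ)
    (ρ : ℝ)
    (hρ : ρ = r * γ ^ 2 * Real.sqrt
        ((⨆ j : Fin q, ∑ i : Fin q,
            |((W.map fun a => |a|)ᵀ * (W.map fun a => |a|)) i j|) *
         (⨆ i : Fin q, ∑ j : Fin q,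
            |((W.map fun a => |a|)ᵀ * (W.map fun a => |a|)) i j|))) :
    (∀ X Y, frobNorm (T X - T Y) ≤ ρ * frobNorm (X - Y)) ∧
    (ρ < 1 → ∃ Xstar, T Xstar = Xstar ∧ (∀ Y, T Y = Y → Y = Xstar) ∧
      ∀ Xseq : ℕ → Matrix (Fin q) (Fin m) ℝ,
        (∀ t, Xseq (t + 1) = T (Xseq t)) →
        ∀ t, frobNorm (Xseq t - Xstar) ≤ ρ ^ t * frobNorm (Xseq 0 - Xstar)) := by
  have hγ0 : 0 ≤ γ := (abs_nonneg _).trans (hγ 0)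
  have hlip : ∀ x y, |φ x - φ y| ≤ γ * |x - y| := by
    intro x y
    have := convex_univ.norm_image_sub_le_of_norm_deriv_le (f := φ) (C := γ) (x := y) (y := x)
      (fun z _ => hφ z) (fun z _ => hγ z) (Set.mem_univ _) (Set.mem_univ _)
    simpa [Real.norm_eq_abs] using this
  set A : Matrix (Fin q) (Fin q) ℝ := (W.map fun a => |a|)ᵀ * (W.map fun a => |a|) with hAdef
  have hAe : ∀ i j, A i j = ∑ k, |W k i| * |W k j| := by
    intro i j
    simp [hAdef, Matrix.mul_apply]
  have hA : ∀ i j, 0 ≤ A i j := by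
    intro i j
    rw [hAe]
    positivity
  set S := ⨆ j : Fin q, ∑ i : Fin q, |A i j| with hSdef
  set R := ⨆ i : Fin q, ∑ j : Fin q, |A i j| with hRdef
  have hR0 : 0 ≤ R := Real.iSup_nonneg fun i => by positivity
  have hS0 : 0 ≤ S := Real.iSup_nonneg fun i => by positivity
  have hR : ∀ i, ∑ j, A i j ≤ R := fun i =>
    (Finset.sum_le_sum fun j _ => le_abs_self (A i j)).trans
      (le_ciSup (f := fun i => ∑ j, |A i j|) (Set.finite_range _).bddAbove i)
  have hS : ∀ j, ∑ i, A i j ≤ S := fun j =>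
    (Finset.sum_le_sum fun i _ => le_abs_self (A i j)).trans
      (le_ciSup (f := fun j => ∑ i, |A i j|) (Set.finite_range _).bddAbove j)
  have hρ0 : 0 ≤ ρ := by rw [hρ]; positivity
  have hent : ∀ X Y k l, |(T X - T Y) k l| ≤ r * γ ^ 2 * ∑ j, A k j * |(X - Y) j l| := by
    intro X Y k l
    rw [Matrix.sub_apply, hT, hT, Matrix.map_apply, Matrix.map_apply]
    have e1 : (C - r • (Wᵀ * ((W * X).map φ - B))) k l - (C - r • (Wᵀ * ((W * Y).map φ - B))) k l
        = - (r * ∑ i, W i k * (φ ((W * X) i l) - φ ((W * Y) i l))) := by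
      simp only [Matrix.sub_apply, Matrix.smul_apply, Matrix.mul_apply, Matrix.transpose_apply,
        Matrix.map_apply, smul_eq_mul, mul_sub, Finset.sum_sub_distrib]
      ring
    have e2 : ∀ i, |φ ((W * X) i l) - φ ((W * Y) i l)| ≤ γ * ∑ j, |W i j| * |(X - Y) j l| := by
      intro i
      refine (hlip _ _).trans (mul_le_mul_of_nonneg_left ?_ hγ0)
      rw [← Matrix.sub_apply, ← Matrix.mul_sub, Matrix.mul_apply]
      refine (Finset.abs_sum_le_sum_abs _ _).trans (le_of_eq ?_)
      simp only [abs_mul]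
    refine (hlip _ _).trans ?_
    rw [e1, abs_neg, abs_mul, abs_of_pos hr]
    have e3 : |∑ i, W i k * (φ ((W * X) i l) - φ ((W * Y) i l))|
        ≤ ∑ i, |W i k| * (γ * ∑ j, |W i j| * |(X - Y) j l|) := by
      refine (Finset.abs_sum_le_sum_abs _ _).trans (Finset.sum_le_sum fun i _ => ?_)
      rw [abs_mul]
      exact mul_le_mul_of_nonneg_left (e2 i) (abs_nonneg _)
    have e4 : ∑ i, |W i k| * (γ * ∑ j, |W i j| * |(X - Y) j l|)
        = γ * ∑ j, A k j * |(X - Y) j l| := by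
      simp_rw [hAe, Finset.sum_mul, Finset.mul_sum]
      rw [Finset.sum_comm]
      refine Finset.sum_congr rfl fun j _ => Finset.sum_congr rfl fun i _ => ?_
      ring
    rw [e4] at e3
    calc γ * (r * |∑ i, W i k * (φ ((W * X) i l) - φ ((W * Y) i l))|)
        ≤ γ * (r * (γ * ∑ j, A k j * |(X - Y) j l|)) := by gcongr
      _ = _ := by ring
  have hL : ∀ X Y, frobNorm (T X - T Y) ≤ ρ * frobNorm (X - Y) := by
    intro X Y
    have hb : ∑ k, ∑ l, ((T X - T Y) k l) ^ 2
        ≤ (r * γ ^ 2) ^ 2 * (S * R) * ∑ k, ∑ l, ((X - Y) k l) ^ 2 := by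
      calc ∑ k, ∑ l, ((T X - T Y) k l) ^ 2
          ≤ ∑ k, ∑ l, (r * γ ^ 2) ^ 2 * (∑ j, A k j * |(X - Y) j l|) ^ 2 := by
            refine Finset.sum_le_sum fun k _ => Finset.sum_le_sum fun l _ => ?_
            rw [← mul_pow, ← sq_abs]
            exact pow_le_pow_left₀ (abs_nonneg _) (hent X Y k l) 2
        _ = (r * γ ^ 2) ^ 2 * ∑ l, ∑ k, (∑ j, A k j * |(X - Y) j l|) ^ 2 := by
            rw [Finset.sum_comm]
            simp_rw [← Finset.mul_sum]
        _ ≤ (r * γ ^ 2) ^ 2 * ∑ l, S * R * ∑ j, |(X - Y) j l| ^ 2 := by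
            refine mul_le_mul_of_nonneg_left ?_ (sq_nonneg _)
            exact Finset.sum_le_sum fun l _ => schur_test A hA _ R S hR hS hR0
        _ = _ := by
            rw [← Finset.mul_sum, Finset.sum_comm]
            simp_rw [sq_abs]
            ring
    unfold frobNorm
    refine (Real.sqrt_le_sqrt hb).trans (le_of_eq ?_)
    rw [Real.sqrt_mul (by positivity), Real.sqrt_mul (by positivity),
      Real.sqrt_sq (by positivity), hρ]
  refine ⟨hL, fun h1 => ?_⟩
  obtain ⟨Xs, hfix, huniq⟩ := contraction_fixed T ρ hρ0 h1 hL
  refine ⟨Xs, hfix, huniq, fun Xseq hX t => ?_⟩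
  induction t with
  | zero => simp
  | succ t ih =>
    have h := hL (Xseq t) Xs
    rw [hfix, ← hX] at h
    refine h.trans ((mul_le_mul_of_nonneg_left ih hρ0).trans (le_of_eq ?_))
    ring
end

section
/- Let E and F be real finite-dimensional inner product spaces, A: E → F a linear map, φ: F → ℝ a convex differentiable function whose gradient is L_φ-Lipschitz, h: E → ℝ convex, and F_obj(x) = φ(Ax) + h(x). Let x* be a minimizer of F_obj. Define sequences by θ₀ = 0, and for k ≥ 1 let θ_k ∈ (0, 1) satisfy 1 − θ_k = √θ_k (1 − θ_{k−1}), let y_k = θ_k x_k − √θ_k (θ_{k−1} x_{k−1} − x_k), and let x_{k+1} be a minimizer of x ↦ ⟨∇φ(A y_k), A(x − y_k)⟩ + (L_φ/2)‖A(x − y_k)‖² + h(x). Set z_k = A(θ_{k−1} x_{k−1} − x_k + (1 − θ_{k−1}) x*). Then for all k ≥ 1: F_obj(x_k) − F_obj(x*) + (L_φ/2)‖z_k‖² ≤ (4/k²)(F_obj(x_1) − F_obj(x*) + (L_φ/2)‖z_1‖²), i.e. the method converges at rate O(k⁻²). -/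
open RealInnerProductSpace

lemma apg_line_deriv {F : Type*} [NormedAddCommGroup F] [InnerProductSpace ℝ F]
    [FiniteDimensional ℝ F] (φ : F → ℝ) (hd : Differentiable ℝ φ) (w d : F) (t : ℝ) :
    HasDerivAt (fun t : ℝ => φ (w + t • d)) ⟪gradient φ (w + t • d), d⟫ t := by
  have h1 : HasFDerivAt φ (fderiv ℝ φ (w + t • d)) (w + t • d) := (hd _).hasFDerivAt
  have h2 : HasDerivAt (fun t : ℝ => w + t • d) d t := by
    simpa using ((hasDerivAt_id t).smul_const d).const_add w
  have h3 := h1.comp_hasDerivAt t h2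
  have h4 : ⟪gradient φ (w + t • d), d⟫ = fderiv ℝ φ (w + t • d) d := by
    simp [gradient]
  rw [h4]
  exact h3

lemma apg_lower {F : Type*} [NormedAddCommGroup F] [InnerProductSpace ℝ F]
    [FiniteDimensional ℝ F] (φ : F → ℝ) (hd : Differentiable ℝ φ)
    (hc : ConvexOn ℝ Set.univ φ) (w d : F) :
    φ w + ⟪gradient φ w, d⟫ ≤ φ (w + d) := by
  have hcl : ConvexOn ℝ Set.univ (fun t : ℝ => φ (w + t • d)) := by
    refine ⟨convex_univ, fun a _ b _ p q hp hq hpq => ?_⟩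
    have := hc.2 (Set.mem_univ (w + a • d)) (Set.mem_univ (w + b • d)) hp hq hpq
    have e : w + (p • a + q • b) • d = p • (w + a • d) + q • (w + b • d) := by
      have : w = (p + q) • w := by rw [hpq, one_smul]
      nth_rewrite 1 [this]
      simp only [smul_eq_mul]
      module
    simpa only [e] using this
  have h0 := apg_line_deriv φ hd w d 0
  have := hcl.le_slope_of_hasDerivAt (Set.mem_univ 0) (Set.mem_univ 1) one_pos h0
  simp [slope_def_field] at this
  simp
  linarith

lemma apg_upper {F : Type*} [NormedAddCommGroup F] [InnerProductSpace ℝ F]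
    [FiniteDimensional ℝ F] (φ : F → ℝ) (hd : Differentiable ℝ φ) (L : ℝ)
    (hLip : ∀ u v : F, ‖gradient φ u - gradient φ v‖ ≤ L * ‖u - v‖) (w d : F) :
    φ (w + d) ≤ φ w + ⟪gradient φ w, d⟫ + L / 2 * ‖d‖ ^ 2 := by
  have hder : ∀ t : ℝ, HasDerivAt
      (fun t : ℝ => φ (w + t • d) - t * ⟪gradient φ w, d⟫ - L / 2 * ‖d‖ ^ 2 * t ^ 2)
      (⟪gradient φ (w + t • d), d⟫ - ⟪gradient φ w, d⟫ - L * ‖d‖ ^ 2 * t) t := by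
    intro t
    have h1 := apg_line_deriv φ hd w d t
    have h2 := (hasDerivAt_id t).mul_const (⟪gradient φ w, d⟫)
    have h3 := ((hasDerivAt_id t).pow 2).const_mul (L / 2 * ‖d‖ ^ 2)
    refine ((h1.sub h2).sub h3).congr_deriv ?_
    simp
    ring
  have hanti := antitoneOn_of_deriv_nonpos (convex_Icc (0:ℝ) 1)
    (fun t _ => (hder t).continuousAt.continuousWithinAt)
    (fun t _ => (hder t).differentiableAt.differentiableWithinAt)
    (fun t ht => by
      rw [(hder t).deriv]
      rw [interior_Icc] at ht
      have h1 := real_inner_le_norm (gradient φ (w + t • d) - gradient φ w) d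
      have h2 := hLip (w + t • d) w
      rw [add_sub_cancel_left, norm_smul, Real.norm_of_nonneg ht.1.le] at h2
      have h3 := mul_le_mul_of_nonneg_right h2 (norm_nonneg d)
      rw [inner_sub_left] at h1
      nlinarith)
  have := hanti (Set.left_mem_Icc.2 zero_le_one) (Set.right_mem_Icc.2 zero_le_one) zero_le_one
  simp at this
  simp
  linarith

lemma apg_prox {E F : Type*}
    [NormedAddCommGroup E] [InnerProductSpace ℝ E]
    [NormedAddCommGroup F] [InnerProductSpace ℝ F]
    (A : E →ₗ[ℝ] F) (h : E → ℝ) (L : ℝ) (hconv : ConvexOn ℝ Set.univ h) (g : F) (y p : E)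
    (hp : ∀ u : E, ⟪g, A (p - y)⟫ + L / 2 * ‖A (p - y)‖ ^ 2 + h p
        ≤ ⟪g, A (u - y)⟫ + L / 2 * ‖A (u - y)‖ ^ 2 + h u) (u : E) :
    ⟪g, A (p - y)⟫ + L / 2 * ‖A (p - y)‖ ^ 2 + h p + L / 2 * ‖A (u - p)‖ ^ 2
        ≤ ⟪g, A (u - y)⟫ + L / 2 * ‖A (u - y)‖ ^ 2 + h u := by
  have key : ∀ t ∈ Set.Ioo (0:ℝ) 1,
      ⟪g, A (p - y)⟫ + L / 2 * ‖A (p - y)‖ ^ 2 + h p + (1 - t) * (L / 2 * ‖A (u - p)‖ ^ 2)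
        ≤ ⟪g, A (u - y)⟫ + L / 2 * ‖A (u - y)‖ ^ 2 + h u := by
    intro t ht
    have h1 := hp ((1 - t) • p + t • u)
    have h2 := hconv.2 (Set.mem_univ p) (Set.mem_univ u) (sub_nonneg.2 ht.2.le) ht.1.le
      (by ring)
    simp only [smul_eq_mul] at h2
    have e1 : A ((1 - t) • p + t • u - y) = A (p - y) + t • A (u - p) := by
      rw [← map_smul, ← map_add]; congr 1; module
    have e2 : A (u - y) = A (p - y) + A (u - p) := by
      rw [← map_add]; congr 1; abel
    rw [e1, norm_add_sq_real, inner_add_right, norm_smul, real_inner_smul_right,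
      real_inner_smul_right, Real.norm_of_nonneg ht.1.le] at h1
    rw [e2, norm_add_sq_real, inner_add_right]
    refine le_of_mul_le_mul_left ?_ ht.1
    nlinarith
  have hc : Filter.Tendsto (fun t : ℝ => ⟪g, A (p - y)⟫ + L / 2 * ‖A (p - y)‖ ^ 2 + h p
      + (1 - t) * (L / 2 * ‖A (u - p)‖ ^ 2)) (nhdsWithin 0 (Set.Ioi 0))
      (nhds (⟪g, A (p - y)⟫ + L / 2 * ‖A (p - y)‖ ^ 2 + h p
      + (1 - 0) * (L / 2 * ‖A (u - p)‖ ^ 2))) :=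
    (Continuous.tendsto (by fun_prop) 0).mono_left nhdsWithin_le_nhds
  have := le_of_tendsto hc (by
    filter_upwards [Ioo_mem_nhdsGT (zero_lt_one (α := ℝ))] with t ht using key t ht)
  simpa using this

theorem apg_convergence_rate {E F : Type*}
    [NormedAddCommGroup E] [InnerProductSpace ℝ E] [FiniteDimensional ℝ E]
    [NormedAddCommGroup F] [InnerProductSpace ℝ F] [FiniteDimensional ℝ F]
    (A : E →ₗ[ℝ] F) (φ : F → ℝ) (h : E → ℝ) (Lφ : ℝ)
    (hφconv : ConvexOn ℝ Set.univ φ) (hφdiff : Differentiable ℝ φ)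
    (hLip : ∀ u v : F, ‖gradient φ u - gradient φ v‖ ≤ Lφ * ‖u - v‖)
    (hconv : ConvexOn ℝ Set.univ h)
    (Fobj : E → ℝ) (hFobj : ∀ x, Fobj x = φ (A x) + h x)
    (xstar : E) (hstar : ∀ x, Fobj xstar ≤ Fobj x)
    (θ : ℕ → ℝ) (x y : ℕ → E)
    (hθ0 : θ 0 = 0)
    (hθ : ∀ k, 1 ≤ k → θ k ∈ Set.Ioo (0:ℝ) 1 ∧
      1 - θ k = Real.sqrt (θ k) * (1 - θ (k - 1)))
    (hy : ∀ k, 1 ≤ k →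
      y k = θ k • x k - Real.sqrt (θ k) • (θ (k - 1) • x (k - 1) - x k))
    (hx : ∀ k, 1 ≤ k → ∀ u : E,
      ⟪gradient φ (A (y k)), A (x (k + 1) - y k)⟫
          + Lφ / 2 * ‖A (x (k + 1) - y k)‖ ^ 2 + h (x (k + 1))
        ≤ ⟪gradient φ (A (y k)), A (u - y k)⟫
          + Lφ / 2 * ‖A (u - y k)‖ ^ 2 + h u)
    (z : ℕ → F)
    (hz : ∀ k, z k = A (θ (k - 1) • x (k - 1) - x k + (1 - θ (k - 1)) • xstar)) :
    ∀ k : ℕ, 1 ≤ k →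
      Fobj (x k) - Fobj xstar + Lφ / 2 * ‖z k‖ ^ 2
        ≤ 4 / (k : ℝ) ^ 2 * (Fobj (x 1) - Fobj xstar + Lφ / 2 * ‖z 1‖ ^ 2) := by
  have hstep : ∀ n : ℕ, Fobj (x (n + 2)) - Fobj xstar + Lφ / 2 * ‖z (n + 2)‖ ^ 2
      ≤ θ (n + 1) * (Fobj (x (n + 1)) - Fobj xstar + Lφ / 2 * ‖z (n + 1)‖ ^ 2) := by
    intro n
    obtain ⟨⟨ht0, ht1⟩, hs⟩ := hθ (n + 1) (by omega)
    have hyk := hy (n + 1) (by omega)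
    have hz1 := hz (n + 1)
    have hz2 := hz (n + 2)
    simp only [Nat.add_sub_cancel, show n + 2 - 1 = n + 1 by omega] at hs hyk hz1 hz2
    set s := Real.sqrt (θ (n + 1)) with hsdef
    have hss : s ^ 2 = θ (n + 1) := Real.sq_sqrt ht0.le
    set u : E := θ (n + 1) • x (n + 1) + (1 - θ (n + 1)) • xstar with hu
    have hp := apg_prox A h Lφ hconv _ _ _ (hx (n + 1) (by omega)) u
    have eu : A (u - y (n + 1)) = s • z (n + 1) := by
      rw [hz1, ← map_smul]
      congr 1
      rw [hu, hyk, hs]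
      module
    have ez : A (u - x (n + 1 + 1)) = z (n + 2) := by
      rw [hz2, hu]
      congr 1
      abel
    have hup := apg_upper φ hφdiff Lφ hLip (A (y (n + 1))) (A (x (n + 1 + 1) - y (n + 1)))
    have hlo := apg_lower φ hφdiff hφconv (A (y (n + 1))) (A (u - y (n + 1)))
    rw [← map_add, add_sub_cancel] at hup hlo
    have c1 := hφconv.2 (Set.mem_univ (A (x (n + 1)))) (Set.mem_univ (A xstar)) ht0.le
      (sub_nonneg.2 ht1.le) (by ring)
    rw [← map_smul, ← map_smul, ← map_add] at c1
    have c2 := hconv.2 (Set.mem_univ (x (n + 1))) (Set.mem_univ xstar) ht0.le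
      (sub_nonneg.2 ht1.le) (by ring)
    rw [← hu] at c1 c2
    simp only [smul_eq_mul] at c1 c2
    have en : ‖A (u - y (n + 1))‖ ^ 2 = θ (n + 1) * ‖z (n + 1)‖ ^ 2 := by
      rw [eu, norm_smul, mul_pow, Real.norm_eq_abs, sq_abs, hss]
    rw [ez, en] at hp
    rw [hFobj, hFobj, hFobj]
    change φ (A (x (n + 1 + 1))) + h (x (n + 1 + 1)) - _ + _ ≤ _
    linarith
  have hlt : ∀ n : ℕ, 0 < 1 - θ n := by
    intro n
    rcases Nat.eq_zero_or_pos n with rfl | hn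
    · rw [hθ0]; norm_num
    · linarith [(hθ n hn).1.2]
  have hsq : ∀ n : ℕ, (1 - θ (n + 1)) ^ 2 = θ (n + 1) * (1 - θ n) ^ 2 := by
    intro n
    obtain ⟨⟨ht0, ht1⟩, hs⟩ := hθ (n + 1) (by omega)
    rw [hs, mul_pow, Real.sq_sqrt ht0.le, Nat.add_sub_cancel]
  have hb : ∀ n : ℕ, (1 - θ n) * ((n : ℝ) + 2) ≤ 2 := by
    intro n
    induction n with
    | zero => rw [hθ0]; norm_num
    | succ n ih =>
      have ha := hlt n
      have hb := hlt (n + 1)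
      have e := hsq n
      have ht0 := (hθ (n + 1) (by omega)).1.1
      obtain ⟨a, rfl⟩ : ∃ a, a = 1 - θ n := ⟨_, rfl⟩
      generalize 1 - θ n = a at *
      have hθb : θ (n + 1) = 1 - (1 - θ (n + 1)) := by ring
      rw [hθb] at e ht0
      simp only [sub_sub_cancel] at e ht0
      have e' : (1 - θ (n + 1)) ^ 2 = (1 - (1 - θ (n + 1))) * a ^ 2 := by
        simpa using e
      generalize 1 - θ (n + 1) = b at *
      have hba : b ≤ a := by
        by_contra hcon
        nlinarith [mul_pos hb (pow_pos ha 2)]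
      have hkey : a * b ≤ 2 * (a - b) := by
        have h1 : (a - b) * (a + b) = b * a ^ 2 := by linarith
        have h2 : a * b * (a + b) ≤ 2 * (a - b) * (a + b) := by
          nlinarith [mul_nonneg (mul_nonneg ha.le hb.le) (sub_nonneg.2 hba)]
        exact le_of_mul_le_mul_right h2 (by linarith)
      push_cast
      refine le_of_mul_le_mul_left ?_ ha
      nlinarith
  have he1 : 0 ≤ Fobj (x 1) - Fobj xstar + Lφ / 2 * ‖z 1‖ ^ 2 := by
    have h1 := (norm_nonneg _).trans (hLip (z 1) 0)
    rw [sub_zero] at h1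
    nlinarith [hstar (x 1), mul_nonneg h1 (norm_nonneg (z 1))]
  have hmain : ∀ n : ℕ, Fobj (x (n + 1)) - Fobj xstar + Lφ / 2 * ‖z (n + 1)‖ ^ 2
      ≤ (1 - θ n) ^ 2 * (Fobj (x 1) - Fobj xstar + Lφ / 2 * ‖z 1‖ ^ 2) := by
    intro n
    induction n with
    | zero => rw [hθ0]; norm_num
    | succ n ih =>
      refine (hstep n).trans ?_
      rw [hsq n, mul_assoc]
      exact mul_le_mul_of_nonneg_left ih (hθ (n + 1) (by omega)).1.1.le
  intro k hk
  obtain ⟨n, rfl⟩ : ∃ n, k = n + 1 := ⟨k - 1, by omega⟩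
  refine (hmain n).trans (mul_le_mul_of_nonneg_right ?_ he1)
  have hn : (0:ℝ) < ((n + 1 : ℕ) : ℝ) := by positivity
  rw [le_div_iff₀ (by positivity), ← mul_pow]
  have h1 : (1 - θ n) * ((n + 1 : ℕ) : ℝ) ≤ 2 := by
    push_cast
    nlinarith [hb n, hlt n]
  nlinarith [mul_pos (hlt n) hn]
end

section
/- Let E and F be real finite-dimensional inner product spaces, A: E → F linear, φ: F → ℝ convex differentiable with L_φ-Lipschitz gradient, h: E → ℝ convex, and F_obj(x) = φ(Ax) + h(x). Fix y ∈ E and let x₊ be a minimizer of x ↦ ⟨∇φ(Ay), A(x − y)⟩ + (L_φ/2)‖A(x − y)‖² + h(x). Then for every u ∈ E: F_obj(x₊) ≤ F_obj(u) + L_φ ⟨A(x₊ − y), A(u − x₊)⟩ + (L_φ/2)‖A(x₊ − y)‖². -/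
open RealInnerProductSpace

theorem aux_line {F : Type*}
    [NormedAddCommGroup F] [InnerProductSpace ℝ F] [FiniteDimensional ℝ F]
    (φ : F → ℝ) (hφdiff : Differentiable ℝ φ) (a d : F) (t : ℝ) :
    HasDerivAt (fun s : ℝ => φ (a + s • d)) ⟪gradient φ (a + t • d), d⟫ t := by
  have h1 := (hφdiff (a + t • d)).hasGradientAt.hasFDerivAt
  have h2 : HasDerivAt (fun s : ℝ => a + s • d) d t := by
    simpa using ((hasDerivAt_id t).smul_const d).const_add a
  have h3 := h1.comp_hasDerivAt t h2
  simpa [Function.comp_def] using h3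

theorem aux_descent {F : Type*}
    [NormedAddCommGroup F] [InnerProductSpace ℝ F] [FiniteDimensional ℝ F]
    (φ : F → ℝ) (L : ℝ) (hφdiff : Differentiable ℝ φ)
    (hLip : ∀ u v : F, ‖gradient φ u - gradient φ v‖ ≤ L * ‖u - v‖) (a d : F) :
    φ (a + d) ≤ φ a + ⟪gradient φ a, d⟫ + L / 2 * ‖d‖ ^ 2 := by
  have hd : ∀ t : ℝ, HasDerivAt
      (fun s : ℝ => φ (a + s • d) - (s * ⟪gradient φ a, d⟫ + L / 2 * ‖d‖ ^ 2 * s ^ 2))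
      (⟪gradient φ (a + t • d), d⟫ - (⟪gradient φ a, d⟫ + L / 2 * ‖d‖ ^ 2 * (2 * t))) t := by
    intro t
    refine (aux_line φ hφdiff a d t).sub (HasDerivAt.add ?_ ?_)
    · simpa using (hasDerivAt_id t).mul_const ⟪gradient φ a, d⟫
    · simpa using (hasDerivAt_pow 2 t).const_mul (L / 2 * ‖d‖ ^ 2)
  have hanti := antitoneOn_of_deriv_nonpos (convex_Icc (0:ℝ) 1)
    (fun t _ => (hd t).continuousAt.continuousWithinAt)
    (fun t _ => (hd t).differentiableAt.differentiableWithinAt)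
    (by
      intro t ht
      rw [interior_Icc] at ht
      rw [(hd t).deriv]
      have h1 := real_inner_le_norm (gradient φ (a + t • d) - gradient φ a) d
      have h2 := hLip (a + t • d) a
      rw [add_sub_cancel_left, norm_smul, Real.norm_of_nonneg ht.1.le] at h2
      have h3 := mul_le_mul_of_nonneg_right h2 (norm_nonneg d)
      rw [inner_sub_left] at h1
      nlinarith)
  have := hanti (Set.left_mem_Icc.2 zero_le_one) (Set.right_mem_Icc.2 zero_le_one) zero_le_one
  simp at this
  simp
  linarith

theorem aux_convex {F : Type*}
    [NormedAddCommGroup F] [InnerProductSpace ℝ F] [FiniteDimensional ℝ F]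
    (φ : F → ℝ) (hc : ConvexOn ℝ Set.univ φ) (hφdiff : Differentiable ℝ φ) (a d : F) :
    φ a + ⟪gradient φ a, d⟫ ≤ φ (a + d) := by
  have h1 : ConvexOn ℝ Set.univ (fun s : ℝ => φ (a + s • d)) := by
    have := hc.comp_affineMap (AffineMap.lineMap a (a + d) : ℝ →ᵃ[ℝ] F)
    simpa [Function.comp_def, AffineMap.lineMap_apply, add_comm] using this
  have h2 := h1.le_slope_of_hasDerivAt (Set.mem_univ 0) (Set.mem_univ 1) zero_lt_one
    (aux_line φ hφdiff a d 0)
  simp [slope_def_field] at h2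
  simp
  linarith

theorem aux_limit (p q : ℝ) (h : ∀ t : ℝ, 0 < t → t ≤ 1 → 0 ≤ t * p + t ^ 2 * q) : 0 ≤ p := by
  by_contra! hp
  have hden : 0 < |q| - p := by have := abs_nonneg q; linarith
  have ht : 0 < -p / (2 * (|q| - p)) := by apply div_pos <;> linarith
  set t := -p / (2 * (|q| - p)) with htd
  have he : t * (2 * (|q| - p)) = -p := by rw [htd]; field_simp
  have hq := le_abs_self q
  have := abs_nonneg q
  have h1 : t ≤ 1 := by
    rw [htd, div_le_one (by linarith)]; linarith
  have h2 := h t ht h1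
  have h3 : 0 ≤ p + t * q := by
    by_contra! hh
    nlinarith
  nlinarith

theorem apg_step_inequality {E F : Type*}
    [NormedAddCommGroup E] [InnerProductSpace ℝ E] [FiniteDimensional ℝ E]
    [NormedAddCommGroup F] [InnerProductSpace ℝ F] [FiniteDimensional ℝ F]
    (A : E →ₗ[ℝ] F) (φ : F → ℝ) (h : E → ℝ) (Lφ : ℝ)
    (hφconv : ConvexOn ℝ Set.univ φ) (hφdiff : Differentiable ℝ φ)
    (hLip : ∀ u v : F, ‖gradient φ u - gradient φ v‖ ≤ Lφ * ‖u - v‖)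
    (hconv : ConvexOn ℝ Set.univ h)
    (Fobj : E → ℝ) (hFobj : ∀ x, Fobj x = φ (A x) + h x)
    (y xp : E)
    (hmin : ∀ u : E,
      ⟪gradient φ (A y), A (xp - y)⟫ + Lφ / 2 * ‖A (xp - y)‖ ^ 2 + h xp
        ≤ ⟪gradient φ (A y), A (u - y)⟫ + Lφ / 2 * ‖A (u - y)‖ ^ 2 + h u) :
    ∀ u : E, Fobj xp ≤ Fobj u + Lφ * ⟪A (xp - y), A (u - xp)⟫
      + Lφ / 2 * ‖A (xp - y)‖ ^ 2 := by
  intro u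
  have hd := aux_descent φ Lφ hφdiff hLip (A y) (A (xp - y))
  have hc := aux_convex φ hφconv hφdiff (A y) (A (u - y))
  have e1 : A y + A (xp - y) = A xp := by rw [← map_add]; congr 1; abel
  have e2 : A y + A (u - y) = A u := by rw [← map_add]; congr 1; abel
  rw [e1] at hd
  rw [e2] at hc
  have e3 : A (u - y) = A (xp - y) + A (u - xp) := by rw [← map_add]; congr 1; abel
  rw [e3, inner_add_right] at hc
  have key := aux_limit
    (⟪gradient φ (A y), A (u - xp)⟫ + Lφ * ⟪A (xp - y), A (u - xp)⟫ + (h u - h xp))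
    (Lφ / 2 * ‖A (u - xp)‖ ^ 2) (by
      intro t ht ht1
      have hm := hmin (xp + t • (u - xp))
      have e4 : A (xp + t • (u - xp) - y) = A (xp - y) + t • A (u - xp) := by
        rw [← map_smul, ← map_add]; congr 1; abel
      rw [e4, inner_add_right, inner_smul_right, norm_add_sq_real, inner_smul_right,
        norm_smul, Real.norm_of_nonneg ht.le] at hm
      have hh := hconv.2 (Set.mem_univ xp) (Set.mem_univ u) (sub_nonneg.2 ht1) ht.le (by ring)
      have e5 : (1 - t) • xp + t • u = xp + t • (u - xp) := by module
      rw [e5, smul_eq_mul, smul_eq_mul] at hh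
      nlinarith)
  rw [hFobj, hFobj]
  linarith
end

section
/- Let (θ_k)_{k≥0} be a real sequence with θ₀ = 0 and, for each k ≥ 1, θ_k ∈ (0, 1) satisfying 1 − θ_k = √θ_k (1 − θ_{k−1}). Then 1 − θ_k < 2/(k + 1) for all k ≥ 0. -/
theorem theta_bound (θ : ℕ → ℝ) (hθ0 : θ 0 = 0)
    (hθ : ∀ k, 1 ≤ k → θ k ∈ Set.Ioo (0:ℝ) 1 ∧
      1 - θ k = Real.sqrt (θ k) * (1 - θ (k - 1))) :
    ∀ k : ℕ, 1 - θ k < 2 / ((k : ℝ) + 1) := by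
  intro k
  induction k with
  | zero => simp [hθ0]
  | succ n ih =>
    obtain ⟨⟨h0, h1⟩, h⟩ := hθ (n + 1) (by omega)
    simp only [Nat.add_sub_cancel] at h
    have hs : 0 < Real.sqrt (θ (n + 1)) := Real.sqrt_pos.mpr h0
    have hsq : Real.sqrt (θ (n + 1)) ^ 2 = θ (n + 1) := Real.sq_sqrt h0.le
    have hn : (0 : ℝ) ≤ n := Nat.cast_nonneg n
    generalize Real.sqrt (θ (n + 1)) = s at *
    obtain ⟨b, hb⟩ : ∃ b, b = 1 - θ n := ⟨_, rfl⟩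
    obtain ⟨a, ha⟩ : ∃ a, a = 1 - θ (n + 1) := ⟨_, rfl⟩
    rw [← hb] at ih h
    rw [← ha] at h ⊢
    have ha0 : 0 < a := by linarith
    have hb0 : 0 < b := by
      by_contra hc
      have := mul_nonneg hs.le (neg_nonneg.mpr (not_lt.mp hc))
      linarith
    rw [lt_div_iff₀ (by positivity)] at ih ⊢
    push_cast
    have key : a * (2 + b) ≤ 2 * b := by
      have h2 : 2 * s + a ≤ 2 := by nlinarith [sq_nonneg (1 - s)]
      have h3 := mul_le_mul_of_nonneg_right h2 hb0.le
      nlinarith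
    have h4 : a * (2 + b) * (n + 2) ≤ 2 * b * (n + 2) :=
      mul_le_mul_of_nonneg_right key (by linarith)
    by_contra hc
    have h5 := mul_le_mul_of_nonneg_right (not_lt.mp hc) (by linarith : 0 ≤ 2 + b)
    nlinarith
end

section
/- Let φ: ℝ → ℝ be a differentiable strictly increasing bijection, W ∈ ℝ^{p×q}, C ∈ ℝ^{q×m}, B ∈ ℝ^{p×m}, μ > 0, ν > 0, and define G(X) = μ ( Σ_{k,l} f(X_{kl}) + ½‖X − C‖²_F ) + ν ( Σ_{k,l} g((WX)_{kl}) + ½‖B − WX‖²_F ), where f(x) = ∫₀ˣ (φ⁻¹(t) − t) dt and g(x) = ∫₀ˣ (φ(t) − t) dt. Then X ∈ ℝ^{q×m} is a minimizer of G if and only if X is a fixed point of the map T(X) = φ(C − (ν/μ) Wᵀ(φ(WX) − B)), with φ applied entrywise. -/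
open Matrix

lemma aux_deriv (ψ : ℝ → ℝ) (hc : Continuous ψ) (c x : ℝ) :
    HasDerivAt (fun x => (∫ t in (0:ℝ)..x, (ψ t - t)) + 1 / 2 * (x - c) ^ 2) (ψ x - c) x := by
  have hc' : Continuous fun t => ψ t - t := hc.sub continuous_id
  have h1 : HasDerivAt (fun x => ∫ t in (0:ℝ)..x, (ψ t - t)) (ψ x - x) x :=
    intervalIntegral.integral_hasDerivAt_right (hc'.intervalIntegrable _ _)
      (hc'.stronglyMeasurableAtFilter _ _) hc'.continuousAt
  have h2 : HasDerivAt (fun x : ℝ => 1 / 2 * (x - c) ^ 2) (x - c) x := by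
    have := (((hasDerivAt_id x).sub_const c).pow 2).const_mul (1 / 2 : ℝ)
    refine this.congr_deriv ?_
    simp
  exact (h1.add h2).congr_deriv (by ring)

lemma aux_convex_s19 (ψ : ℝ → ℝ) (hc : Continuous ψ) (hm : Monotone ψ) (c x y : ℝ) :
    (∫ t in (0:ℝ)..x, (ψ t - t)) + 1 / 2 * (x - c) ^ 2 + (ψ x - c) * (y - x) ≤
    (∫ t in (0:ℝ)..y, (ψ t - t)) + 1 / 2 * (y - c) ^ 2 := by
  have hd := aux_deriv ψ hc c
  set h := (fun x => (∫ t in (0:ℝ)..x, (ψ t - t)) + 1 / 2 * (x - c) ^ 2) with hh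
  change h x + (ψ x - c) * (y - x) ≤ h y
  have hcont : Continuous h := continuous_iff_continuousAt.2 fun z => (hd z).continuousAt
  rcases lt_trichotomy x y with hxy | rfl | hxy
  · obtain ⟨z, hz, he⟩ := exists_hasDerivAt_eq_slope h (fun z => ψ z - c) hxy
      hcont.continuousOn (fun z _ => hd z)
    rw [eq_div_iff (by linarith)] at he
    have := hm hz.1.le
    nlinarith
  · simp
  · obtain ⟨z, hz, he⟩ := exists_hasDerivAt_eq_slope h (fun z => ψ z - c) hxy
      hcont.continuousOn (fun z _ => hd z)
    rw [eq_div_iff (by linarith)] at he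
    have := hm hz.2.le
    nlinarith

lemma aux_adj {p q m : ℕ} (W : Matrix (Fin p) (Fin q) ℝ) (A : Matrix (Fin p) (Fin m) ℝ)
    (E : Matrix (Fin q) (Fin m) ℝ) :
    ∑ k, ∑ l, A k l * (W * E) k l = ∑ k, ∑ l, (Wᵀ * A) k l * E k l := by
  have h : ∀ {r : ℕ} (P Q : Matrix (Fin r) (Fin m) ℝ),
      ∑ k, ∑ l, P k l * Q k l = (Pᵀ * Q).trace := by
    intro r P Q
    simp only [Matrix.trace, Matrix.diag, Matrix.mul_apply, Matrix.transpose_apply]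
    exact Finset.sum_comm
  rw [h, h, Matrix.transpose_mul, Matrix.transpose_transpose, Matrix.mul_assoc]

theorem lpom_subproblem_min_iff_fixed_point (p q m : ℕ)
    (φ : ℝ ≃ ℝ) (hφ : StrictMono φ) (hdiff : Differentiable ℝ (φ : ℝ → ℝ))
    (W : Matrix (Fin p) (Fin q) ℝ) (C : Matrix (Fin q) (Fin m) ℝ)
    (B : Matrix (Fin p) (Fin m) ℝ) (μ ν : ℝ) (hμ : 0 < μ) (hν : 0 < ν)
    (G : Matrix (Fin q) (Fin m) ℝ → ℝ)
    (hG : ∀ X, G X = μ * ((∑ k, ∑ l, ∫ t in (0:ℝ)..(X k l), (φ.symm t - t))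
          + 1 / 2 * ∑ k, ∑ l, (X k l - C k l) ^ 2)
        + ν * ((∑ k, ∑ l, ∫ t in (0:ℝ)..((W * X) k l), (φ t - t))
          + 1 / 2 * ∑ k, ∑ l, (B k l - (W * X) k l) ^ 2)) :
    ∀ X : Matrix (Fin q) (Fin m) ℝ,
      (∀ Z, G X ≤ G Z) ↔
        X = (C - (ν / μ) • (Wᵀ * ((W * X).map φ - B))).map φ := by
  intro X
  have hms : StrictMono φ.symm := by
    intro a b hab
    rw [← hφ.lt_iff_lt]
    simpa using hab
  have hcs : Continuous φ.symm := hms.monotone.continuous_of_surjective φ.symm.surjective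
  have hc : Continuous φ := hdiff.continuous
  have hG' : ∀ X, G X = μ * (∑ k, ∑ l, ((∫ t in (0:ℝ)..(X k l), (φ.symm t - t))
          + 1 / 2 * (X k l - C k l) ^ 2))
        + ν * (∑ k, ∑ l, ((∫ t in (0:ℝ)..((W * X) k l), (φ t - t))
          + 1 / 2 * ((W * X) k l - B k l) ^ 2)) := by
    intro X
    rw [hG]
    simp only [Finset.sum_add_distrib, Finset.mul_sum]
    simp only [sub_sq_comm (B _ _)]
  set S := Wᵀ * ((W * X).map φ - B) with hS
  set D : Matrix (Fin q) (Fin m) ℝ :=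
    fun k l => μ * (φ.symm (X k l) - C k l) + ν * S k l with hD
  have hsum : ∀ E : Matrix (Fin q) (Fin m) ℝ,
      μ * (∑ k, ∑ l, (φ.symm (X k l) - C k l) * E k l)
        + ν * (∑ k, ∑ l, (φ ((W * X) k l) - B k l) * (W * E) k l)
      = ∑ k, ∑ l, D k l * E k l := by
    intro E
    have := aux_adj W ((W * X).map φ - B) E
    simp only [Matrix.sub_apply, Matrix.map_apply] at this
    rw [this, ← hS]
    simp only [Finset.mul_sum, ← Finset.sum_add_distrib, hD]
    refine Finset.sum_congr rfl fun k _ => Finset.sum_congr rfl fun l _ => ?_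
    ring
  have hfix : X = (C - (ν / μ) • S).map φ ↔ ∀ k l, D k l = 0 := by
    rw [← Matrix.ext_iff]
    refine forall_congr' fun k => forall_congr' fun l => ?_
    simp only [Matrix.map_apply, Matrix.sub_apply, Matrix.smul_apply, smul_eq_mul, hD]
    rw [← Equiv.symm_apply_eq]
    constructor
    · intro h
      rw [h]; field_simp; ring
    · intro h
      field_simp
      linarith
  rw [hfix]
  constructor
  · intro hmin
    have hder : HasDerivAt (fun t : ℝ => G (X + t • D)) (∑ k, ∑ l, D k l * D k l) 0 := by
      rw [← hsum D]
      simp only [hG']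
      have lin : ∀ a b : ℝ, HasDerivAt (fun t : ℝ => a + t * b) b 0 := fun a b => by
        simpa using ((hasDerivAt_id (0:ℝ)).mul_const b).const_add a
      have key : ∀ (ψ : ℝ → ℝ), Continuous ψ → ∀ a b c : ℝ, HasDerivAt
          (fun t : ℝ => (∫ s in (0:ℝ)..(a + t * b), (ψ s - s)) + 1 / 2 * (a + t * b - c) ^ 2)
          ((ψ a - c) * b) 0 := by
        intro ψ hψ a b c
        have h := aux_deriv ψ hψ c (a + 0 * b)
        have := HasDerivAt.comp (0:ℝ) h (lin a b)
        simpa [Function.comp_def] using this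
      simp only [Matrix.mul_add, Matrix.mul_smul, Matrix.add_apply, Matrix.smul_apply, smul_eq_mul]
      refine HasDerivAt.add (HasDerivAt.const_mul _ ?_) (HasDerivAt.const_mul _ ?_)
      · exact HasDerivAt.fun_sum fun k _ => HasDerivAt.fun_sum fun l _ => key _ hcs _ _ _
      · exact HasDerivAt.fun_sum fun k _ => HasDerivAt.fun_sum fun l _ => key _ hc _ _ _
    have hloc : IsLocalMin (fun t : ℝ => G (X + t • D)) 0 :=
      Filter.Eventually.of_forall fun t => by simpa using hmin (X + t • D)
    have h0 := hloc.hasDerivAt_eq_zero hder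
    intro k l
    rw [Finset.sum_eq_zero_iff_of_nonneg
      (fun k _ => Finset.sum_nonneg fun l _ => mul_self_nonneg _)] at h0
    have h1 := h0 k (Finset.mem_univ _)
    rw [Finset.sum_eq_zero_iff_of_nonneg (fun l _ => mul_self_nonneg _)] at h1
    exact mul_self_eq_zero.1 (h1 l (Finset.mem_univ _))
  · intro h0 Z
    have hs := hsum (Z - X)
    simp only [h0, zero_mul, Finset.sum_const_zero] at hs
    have i1 := Finset.sum_le_sum fun k (_ : k ∈ Finset.univ) =>
      Finset.sum_le_sum fun l (_ : l ∈ Finset.univ) =>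
        aux_convex_s19 φ.symm hcs hms.monotone (C k l) (X k l) (Z k l)
    have i2 := Finset.sum_le_sum fun k (_ : k ∈ Finset.univ) =>
      Finset.sum_le_sum fun l (_ : l ∈ Finset.univ) =>
        aux_convex_s19 φ hc hφ.monotone (B k l) ((W * X) k l) ((W * Z) k l)
    have j1 := mul_le_mul_of_nonneg_left i1 hμ.le
    have j2 := mul_le_mul_of_nonneg_left i2 hν.le
    simp only [Matrix.mul_sub, Matrix.sub_apply] at hs
    rw [hG', hG']
    simp only [Finset.sum_add_distrib, mul_add] at j1 j2 ⊢
    linarith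
end
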